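/- Let u ∈ C³(𝕋) be bell shaped: u' > 0 on (0, x_max), u' < 0 on (x_max, 2π), with exactly two simple inflection points ξ₋ ∈ (0, x_max) and ξ₊ ∈ (x_max, 2π) (u''(ξ±) = 0, u'''(ξ±) ≠ 0). Then there exists N₀ such that for every N ≥ N₀, the truncated Fourier series u_N is comonotone with u: there exist x_min(N) → 0 and x_max(N) → x_max as N → ∞ such that u_N is strictly increasing on (x_min(N), x_max(N)) and strictly decreasing on (x_max(N), x_min(N) + 2π). -/

import Mathlib

open Complex Filter

lemma aux_local (g g' : ℝ → ℝ) (gN gN' : ℕ → ℝ → ℝ) (a : ℝ)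
    (hg : ∀ x, HasDerivAt g (g' x) x) (hg' : Continuous g')
    (hgN : ∀ N x, HasDerivAt (gN N) (gN' N x) x)
    (h0 : TendstoUniformly gN g atTop) (h1 : TendstoUniformly gN' g' atTop)
    (ha : g a = 0) (ha' : 0 < g' a) :
    ∃ δ > 0, ∃ x : ℕ → ℝ, Tendsto x atTop (nhds a) ∧ ∀ᶠ N in atTop,
      (∀ y, x N < y → y ≤ a + δ → 0 < gN N y) ∧ (∀ y, a - δ ≤ y → y < x N → gN N y < 0) := by
  have hev : ∀ᶠ y in nhds a, g' a / 2 < g' y :=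
    hg'.continuousAt.eventually (lt_mem_nhds (by linarith))
  obtain ⟨δ, hδ, hball⟩ := Metric.nhds_basis_closedBall.eventually_iff.1 hev
  have hd : ∀ y ∈ Set.Icc (a - δ) (a + δ), g' a / 2 < g' y := by
    intro y hy
    apply hball
    rw [Real.closedBall_eq_Icc]; exact hy
  have mono : ∀ (f f' : ℝ → ℝ), (∀ x, HasDerivAt f (f' x) x) →
      (∀ y ∈ Set.Icc (a - δ) (a + δ), 0 < f' y) → StrictMonoOn f (Set.Icc (a - δ) (a + δ)) := by
    intro f f' hf hp
    apply strictMonoOn_of_deriv_pos (convex_Icc _ _)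
      (fun x _ => (hf x).continuousAt.continuousWithinAt)
    intro x hx
    rw [(hf x).deriv]
    exact hp x (interior_subset hx)
  have gm := mono g g' hg (fun y hy => by linarith [hd y hy])
  have gNm : ∀ᶠ N in atTop, StrictMonoOn (gN N) (Set.Icc (a - δ) (a + δ)) := by
    filter_upwards [Metric.tendstoUniformly_iff.1 h1 (g' a / 2) (by linarith)] with N hN
    apply mono _ _ (hgN N)
    intro y hy
    have := hN y
    rw [Real.dist_eq, abs_lt] at this
    linarith [hd y hy]
  have sgn : ∀ ε, 0 < ε → ε ≤ δ → ∀ᶠ N in atTop, gN N (a - ε) < 0 ∧ 0 < gN N (a + ε) := by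
    intro ε he hed
    have e1 : g (a - ε) < 0 := by
      rw [← ha]; exact gm ⟨by linarith, by linarith⟩ ⟨by linarith, by linarith⟩ (by linarith)
    have e2 : 0 < g (a + ε) := by
      rw [← ha]; exact gm ⟨by linarith, by linarith⟩ ⟨by linarith, by linarith⟩ (by linarith)
    exact ((h0.tendsto_at _).eventually (gt_mem_nhds e1)).and
      ((h0.tendsto_at _).eventually (lt_mem_nhds e2))
  classical
  let x : ℕ → ℝ := fun N =>
    if h : ∃ z ∈ Set.Icc (a - δ) (a + δ), gN N z = 0 then h.choose else a
  have hx : ∀ᶠ N in atTop, x N ∈ Set.Icc (a - δ) (a + δ) ∧ gN N (x N) = 0 := by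
    filter_upwards [sgn δ hδ le_rfl] with N hN
    have h : ∃ z ∈ Set.Icc (a - δ) (a + δ), gN N z = 0 := by
      have := intermediate_value_Icc (show a - δ ≤ a + δ by linarith)
        (f := gN N) (fun x _ => (hgN N x).continuousAt.continuousWithinAt)
      obtain ⟨z, hz, h⟩ := this ⟨hN.1.le, hN.2.le⟩
      exact ⟨z, hz, h⟩
    simp only [x, dif_pos h]
    exact h.choose_spec
  refine ⟨δ, hδ, x, ?_, ?_⟩
  · rw [Metric.tendsto_nhds]
    intro ε he
    have hm : 0 < min (ε/2) δ := lt_min (by linarith) hδ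
    filter_upwards [hx, gNm, sgn (min (ε/2) δ) hm (min_le_right _ _)] with N hN hmN hs
    have hle := min_le_left (ε/2) δ
    have hle2 := min_le_right (ε/2) δ
    have p1 : a - min (ε/2) δ < x N := by
      by_contra! hc
      have := hmN.monotoneOn hN.1 ⟨by linarith, by linarith⟩ hc
      linarith
    have p2 : x N < a + min (ε/2) δ := by
      by_contra! hc
      have := hmN.monotoneOn ⟨by linarith, by linarith⟩ hN.1 hc
      linarith
    rw [Real.dist_eq, abs_lt]
    constructor <;> linarith
  · filter_upwards [hx, gNm] with N hN hmN
    constructor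
    · intro y h1 h2
      rw [← hN.2]
      exact hmN hN.1 ⟨by linarith [hN.1.1], h2⟩ h1
    · intro y h1 h2
      rw [← hN.2]
      exact hmN ⟨h1, by linarith [hN.1.2]⟩ hN.1 h2

lemma aux_cpt (g : ℝ → ℝ) (gN : ℕ → ℝ → ℝ) (hg : Continuous g)
    (h0 : TendstoUniformly gN g atTop) (a b : ℝ) (hpos : ∀ y ∈ Set.Icc a b, 0 < g y) :
    ∀ᶠ N in atTop, ∀ y ∈ Set.Icc a b, 0 < gN N y := by
  rcases (Set.Icc a b).eq_empty_or_nonempty with he | hne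
  · simp [he]
  obtain ⟨z, hz, hmin⟩ := isCompact_Icc.exists_isMinOn hne hg.continuousOn
  filter_upwards [Metric.tendstoUniformly_iff.1 h0 (g z) (hpos z hz)] with N hN y hy
  have := hN y
  rw [Real.dist_eq, abs_lt] at this
  have h2 : g z ≤ g y := hmin hy
  linarith

lemma aux_main (g g' : ℝ → ℝ) (gN gN' : ℕ → ℝ → ℝ) (b T : ℝ) (hb : b ∈ Set.Ioo 0 T)
    (hper : ∀ x, g (x + T) = g x) (hperN : ∀ N x, gN N (x + T) = gN N x)
    (hg : ∀ x, HasDerivAt g (g' x) x) (hg' : Continuous g')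
    (hgN : ∀ N x, HasDerivAt (gN N) (gN' N x) x)
    (h0 : TendstoUniformly gN g atTop) (h1 : TendstoUniformly gN' g' atTop)
    (hinc : ∀ x ∈ Set.Ioo 0 b, 0 < g x)
    (hdec : ∀ x ∈ Set.Ioo b T, g x < 0)
    (hn0 : g' 0 ≠ 0) (hnb : g' b ≠ 0) :
    ∃ (x y : ℕ → ℝ), Tendsto x atTop (nhds 0) ∧ Tendsto y atTop (nhds b) ∧
      ∀ᶠ N in atTop, (∀ z ∈ Set.Ioo (x N) (y N), 0 < gN N z) ∧
        (∀ z ∈ Set.Ioo (y N) (x N + T), gN N z < 0) := by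
  obtain ⟨hb0, hbT⟩ := hb
  have hgc : Continuous g := continuous_iff_continuousAt.2 fun x => (hg x).continuousAt
  have neg0 : ∀ x ∈ Set.Ioo (b - T) 0, g x < 0 := by
    intro x hx
    rw [← hper]
    exact hdec _ ⟨by linarith [hx.1], by linarith [hx.2]⟩
  have cl : ∀ (f : ℝ → ℝ) (p q : ℝ), Continuous f → p < q → (∀ x ∈ Set.Ioo p q, 0 < f x) →
      0 ≤ f p ∧ 0 ≤ f q := by
    intro f p q hf hpq h
    have hcl : Set.Icc p q ⊆ {x | 0 ≤ f x} := by
      rw [← closure_Ioo hpq.ne]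
      exact closure_minimal (fun x hx => (h x hx).le) (isClosed_le continuous_const hf)
    exact ⟨hcl (Set.left_mem_Icc.2 hpq.le), hcl (Set.right_mem_Icc.2 hpq.le)⟩
  have c1 := cl g 0 b hgc hb0 hinc
  have c2 := cl (fun x => - g x) b T hgc.neg hbT (fun x hx => by simpa using hdec x hx)
  have gT : g T = g 0 := by simpa using hper 0
  have g00 : g 0 = 0 := by have := c2.2; rw [gT] at this; linarith [c1.1]
  have gb0 : g b = 0 := by have := c2.1; linarith [c1.2]
  -- sign of derivative
  have dsg : ∀ (f f' : ℝ → ℝ) (a q : ℝ), HasDerivAt f (f' a) a → f a = 0 → a < q →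
      (∀ x ∈ Set.Ioo a q, 0 < f x) → 0 ≤ f' a := by
    intro f f' a q hf hfa haq h
    have ht := hf.tendsto_slope
    have ht2 := ht.mono_left (nhdsWithin_mono a (s := Set.Ioi a) (by intro x hx; exact ne_of_gt hx))
    refine ge_of_tendsto ht2 ?_
    filter_upwards [Ioo_mem_nhdsGT haq] with x hx
    rw [slope_def_field, hfa]
    have := h x hx
    exact div_nonneg (by linarith) (by linarith [hx.1])
  have d0 : 0 < g' 0 := lt_of_le_of_ne (dsg g g' 0 b (hg 0) g00 hb0 hinc) (Ne.symm hn0)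
  have db : 0 < - g' b := by
    refine lt_of_le_of_ne (dsg (fun x => - g x) (fun x => - g' x) b T (hg b).neg (by simp [gb0]) hbT
      (fun x hx => by simpa using hdec x hx)) (by simpa using hnb)
  have h0n : TendstoUniformly (fun N x => - gN N x) (fun x => - g x) atTop := by
    rw [Metric.tendstoUniformly_iff] at h0 ⊢; simpa using h0
  have h1n : TendstoUniformly (fun N x => - gN' N x) (fun x => - g' x) atTop := by
    rw [Metric.tendstoUniformly_iff] at h1 ⊢; simpa using h1
  obtain ⟨δ, hδ, x, hx, hxN⟩ := aux_local g g' gN gN' 0 hg hg' hgN h0 h1 g00 d0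
  obtain ⟨η, hη, y, hy, hyN⟩ := aux_local (fun x => - g x) (fun x => - g' x)
    (fun N x => - gN N x) (fun N x => - gN' N x) b (fun x => (hg x).neg) hg'.neg
    (fun N x => (hgN N x).neg) h0n h1n (by simp [gb0]) db
  refine ⟨x, y, hx, hy, ?_⟩
  have k1 := aux_cpt g gN hgc h0 δ (b - η)
    (fun z hz => hinc z ⟨by linarith [hz.1], by linarith [hz.2]⟩)
  have k2 := aux_cpt (fun x => - g x) (fun N x => - gN N x) hgc.neg h0n (b + η) (T - δ)
    (fun z hz => by simpa using hdec z ⟨by linarith [hz.1], by linarith [hz.2]⟩)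
  filter_upwards [hxN, hyN, k1, k2] with N a1 a2 a3 a4
  constructor
  · intro z hz
    by_cases q1 : z ≤ δ
    · exact a1.1 z hz.1 (by linarith)
    by_cases q2 : b - η ≤ z
    · simpa using a2.2 z q2 hz.2
    · push Not at q1 q2
      exact a3 z ⟨q1.le, q2.le⟩
  · intro z hz
    by_cases q1 : z ≤ b + η
    · simpa using a2.1 z hz.1 q1
    by_cases q2 : T - δ ≤ z
    · have := a1.2 (z - T) (by linarith) (by linarith [hz.2])
      rw [← hperN] at this
      simpa using this
    · push Not at q1 q2
      simpa using a4 z ⟨q1.le, q2.le⟩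

noncomputable def fcf (f : ℝ → ℝ) (k : ℤ) : ℂ := (1 / (2 * Real.pi) : ℂ) *
  ∫ y in (0 : ℝ)..(2 * Real.pi), (f y : ℂ) * Complex.exp (-(k : ℂ) * y * Complex.I)

noncomputable def fS (f : ℝ → ℝ) (N : ℕ) (x : ℝ) : ℝ :=
  (∑ k ∈ Finset.Icc (-(N : ℤ)) (N : ℤ), fcf f k * Complex.exp ((k : ℂ) * x * Complex.I)).re

lemma aux_cexp_per (k : ℤ) : cexp ((k : ℂ) * (2 * Real.pi) * I) = 1 := by
  rw [mul_assoc]; exact Complex.exp_int_mul_two_pi_mul_I k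

lemma fS_per (f : ℝ → ℝ) (N : ℕ) (x : ℝ) : fS f N (x + 2 * Real.pi) = fS f N x := by
  unfold fS
  congr 1
  refine Finset.sum_congr rfl fun k _ => ?_
  congr 1
  push_cast
  rw [mul_add, add_mul, Complex.exp_add, aux_cexp_per, mul_one]

lemma fcf_deriv (f f' : ℝ → ℝ) (hper : ∀ x, f (x + 2 * Real.pi) = f x)
    (hf : ∀ x, HasDerivAt f (f' x) x) (hf' : Continuous f') (k : ℤ) :
    fcf f' k = (k : ℂ) * I * fcf f k := by
  have hE : ∀ y : ℝ, HasDerivAt (fun y : ℝ => cexp (-(k : ℂ) * y * I))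
      (cexp (-(k : ℂ) * y * I) * (-(k : ℂ) * I)) y := by
    intro y
    have h1 : HasDerivAt (fun y : ℝ => -(k : ℂ) * y * I) (-(k : ℂ) * I) y := by
      have := ((Complex.ofRealCLM.hasDerivAt (x := y)).const_mul (-(k : ℂ))).mul_const I
      simpa using this
    exact h1.cexp
  have hfC : ∀ y : ℝ, HasDerivAt (fun y : ℝ => (f y : ℂ)) (f' y : ℂ) y :=
    fun y => (hf y).ofReal_comp
  have key := intervalIntegral.integral_mul_deriv_eq_deriv_mul (a := 0) (b := 2 * Real.pi)
    (u := fun y : ℝ => (f y : ℂ)) (u' := fun y => (f' y : ℂ))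
    (v := fun y : ℝ => cexp (-(k : ℂ) * y * I))
    (v' := fun y : ℝ => cexp (-(k : ℂ) * y * I) * (-(k : ℂ) * I))
    (fun y _ => hfC y) (fun y _ => hE y)
    (Continuous.intervalIntegrable (by fun_prop) _ _)
    (Continuous.intervalIntegrable (by fun_prop) _ _)
  have h2 : f (2 * Real.pi) = f 0 := by simpa using hper 0
  have h3 : cexp (-(k : ℂ) * ((2 * Real.pi : ℝ) : ℂ) * I) = 1 := by
    have := aux_cexp_per (-k)
    push_cast at this ⊢
    exact this
  simp only [h2, h3] at key
  have h4 : (∫ y in (0:ℝ)..(2 * Real.pi), (f y : ℂ) * (cexp (-(k : ℂ) * y * I) * (-(k : ℂ) * I)))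
      = (∫ y in (0:ℝ)..(2 * Real.pi), (f y : ℂ) * cexp (-(k : ℂ) * y * I)) * (-(k : ℂ) * I) := by
    rw [← intervalIntegral.integral_mul_const]
    congr 1; ext y; ring
  rw [h4] at key
  simp at key
  unfold fcf
  simp only [neg_mul] at key ⊢
  linear_combination (-(1 / (2 * Real.pi)) : ℂ) * key

lemma fS_deriv (f f' : ℝ → ℝ) (hper : ∀ x, f (x + 2 * Real.pi) = f x)
    (hf : ∀ x, HasDerivAt f (f' x) x) (hf' : Continuous f') (N : ℕ) (x : ℝ) :
    HasDerivAt (fS f N) (fS f' N x) x := by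
  have hE : ∀ k : ℤ, HasDerivAt (fun y : ℝ => fcf f k * cexp ((k : ℂ) * y * I))
      (fcf f' k * cexp ((k : ℂ) * x * I)) x := by
    intro k
    have h1 : HasDerivAt (fun y : ℝ => (k : ℂ) * y * I) ((k : ℂ) * I) x := by
      have := ((Complex.ofRealCLM.hasDerivAt (x := x)).const_mul (k : ℂ)).mul_const I
      simpa using this
    have := h1.cexp.const_mul (fcf f k)
    rw [fcf_deriv f f' hper hf hf']
    have e : (k : ℂ) * I * fcf f k * cexp ((k : ℂ) * x * I) =
        fcf f k * (cexp ((k : ℂ) * x * I) * ((k : ℂ) * I)) := by ring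
    rw [e]
    exact this
  have hs := HasDerivAt.fun_sum (u := Finset.Icc (-(N : ℤ)) (N : ℤ)) (fun k _ => hE k)
  exact (Complex.reCLM.hasFDerivAt.comp_hasDerivAt x hs)

lemma fS_unif (f f' : ℝ → ℝ) (hper : ∀ x, f (x + 2 * Real.pi) = f x)
    (hper' : ∀ x, f' (x + 2 * Real.pi) = f' x)
    (hf : ∀ x, HasDerivAt f (f' x) x) (hf' : Continuous f') :
    TendstoUniformly (fS f) f atTop := by
  haveI : Fact (0 < 2 * Real.pi) := ⟨Real.two_pi_pos⟩
  have hfc : Continuous f := continuous_iff_continuousAt.2 fun x => (hf x).continuousAt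
  -- lift
  have lift : ∀ h : ℝ → ℝ, Continuous h → (∀ x, h (x + 2 * Real.pi) = h x) →
      ∃ F : C(AddCircle (2 * Real.pi), ℂ), (∀ x : ℝ, F (x : AddCircle (2 * Real.pi)) = (h x : ℂ)) ∧
        ∀ k, fourierCoeff F k = fcf h k := by
    intro h hc hp
    have hp' : Function.Periodic (fun x => (h x : ℂ)) (2 * Real.pi) := fun x => by simp [hp]
    have hc' : Continuous hp'.lift := by
      apply continuous_coinduced_dom.2
      exact Complex.continuous_ofReal.comp hc
    refine ⟨⟨hp'.lift, hc'⟩, fun x => rfl, fun k => ?_⟩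
    rw [fourierCoeff_eq_intervalIntegral _ k 0, fcf, zero_add, Complex.real_smul]
    congr 1
    · push_cast; rfl
    · congr 1
      ext y
      rw [fourier_coe_apply, smul_eq_mul, mul_comm]
      congr 2
      push_cast
      have : (Real.pi : ℂ) ≠ 0 := by exact_mod_cast Real.pi_ne_zero
      field_simp
  obtain ⟨F, hF, hFc⟩ := lift f hfc hper
  obtain ⟨G, hG, hGc⟩ := lift f' hf' hper'
  have sq : Summable fun k : ℤ => ‖fcf f' k‖ ^ 2 := by
    have := (hasSum_sq_fourierCoeff (ContinuousMap.toLp (E := ℂ) 2 AddCircle.haarAddCircle ℂ G)).summable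
    simpa only [fourierCoeff_toLp, hGc] using this
  have sq2 : Summable fun k : ℤ => 1 / (k : ℝ) ^ 2 :=
    Real.summable_one_div_int_pow.2 (by norm_num)
  have summ : Summable (fourierCoeff F) := by
    have h1 : Summable fun k : ℤ => ‖fcf f' k‖ ^ 2 + 1 / (k : ℝ) ^ 2 := sq.add sq2
    refine Summable.of_norm_bounded_eventually h1 ?_
    rw [Filter.eventually_cofinite]
    refine (Set.finite_singleton (0 : ℤ)).subset fun k hk => ?_
    by_contra hk0
    apply hk
    have hk0 : (k : ℝ) ≠ 0 := by exact_mod_cast hk0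
    have hkp : 0 < |(k : ℝ)| := abs_pos.2 hk0
    rw [hFc, fcf_deriv f f' hper hf hf']
    have : ‖(k : ℂ) * I * fcf f k‖ = |(k : ℝ)| * ‖fcf f k‖ := by
      simp
    rw [this, mul_pow, sq_abs]
    have e : ‖fcf f k‖ = (|(k : ℝ)| * ‖fcf f k‖) * (1 / |(k : ℝ)|) := by field_simp
    have e2 : (1 / |(k : ℝ)|) ^ 2 = 1 / (k : ℝ) ^ 2 := by rw [div_pow, sq_abs, one_pow]
    rw [← e2]
    have e3 : (k : ℝ) ^ 2 * ‖fcf f k‖ ^ 2 = (|(k : ℝ)| * ‖fcf f k‖) ^ 2 := by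
      rw [mul_pow, sq_abs]
    rw [e3]
    nlinarith [sq_nonneg ((|(k : ℝ)| * ‖fcf f k‖) - (1 / |(k : ℝ)|)),
      sq_nonneg (|(k : ℝ)| * ‖fcf f k‖), sq_nonneg (1 / |(k : ℝ)|)]
  have hs := hasSum_fourier_series_of_summable summ
  have ht : Tendsto (fun N : ℕ => ∑ k ∈ Finset.Icc (-(N : ℤ)) (N : ℤ),
      fourierCoeff F k • fourier (T := 2 * Real.pi) k) atTop (nhds F) :=
    hs.comp Finset.tendsto_Icc_neg
  rw [Metric.tendstoUniformly_iff]
  intro ε hε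
  rw [Metric.tendsto_nhds] at ht
  filter_upwards [ht ε hε] with N hN x
  refine lt_of_le_of_lt ?_ hN
  have hle := ContinuousMap.dist_apply_le_dist (f := ∑ k ∈ Finset.Icc (-(N : ℤ)) (N : ℤ),
      fourierCoeff F k • fourier (T := 2 * Real.pi) k) (g := F) (x : AddCircle (2 * Real.pi))
  refine le_trans ?_ hle
  have hval : (∑ k ∈ Finset.Icc (-(N : ℤ)) (N : ℤ),
      fourierCoeff F k • fourier (T := 2 * Real.pi) k) (x : AddCircle (2 * Real.pi)) =
      ∑ k ∈ Finset.Icc (-(N : ℤ)) (N : ℤ), fcf f k * cexp ((k : ℂ) * x * I) := by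
    rw [ContinuousMap.sum_apply]
    refine Finset.sum_congr rfl fun k _ => ?_
    rw [ContinuousMap.smul_apply, smul_eq_mul, hFc, fourier_coe_apply]
    congr 2
    push_cast
    have : (Real.pi : ℂ) ≠ 0 := by exact_mod_cast Real.pi_ne_zero
    field_simp
  rw [hval, hF, dist_comm, Real.dist_eq, dist_eq_norm]
  have := Complex.abs_re_le_norm ((∑ k ∈ Finset.Icc (-(N : ℤ)) (N : ℤ),
    fcf f k * cexp ((k : ℂ) * x * I)) - (f x : ℂ))
  rwa [Complex.sub_re, Complex.ofReal_re] at this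

/-- Comonotone approximation of a bell shaped function by its truncated Fourier series:
for a `C³`, `2π`-periodic bell shaped `u` (increasing on `(0, x_max)`, decreasing on
`(x_max, 2π)`, with exactly two simple inflection points), there exists `N₀` such that
for every `N ≥ N₀` the truncated Fourier series `u_N` is strictly increasing on
`(x_min(N), x_max(N))` and strictly decreasing on `(x_max(N), x_min(N)+2π)`, where
`x_min(N) → 0` and `x_max(N) → x_max`. -/
theorem stmt_6 (u : ℝ → ℝ) (hper : Function.Periodic u (2 * Real.pi))
    (hu : ContDiff ℝ 3 u) (xmax : ℝ) (hxmax : xmax ∈ Set.Ioo 0 (2 * Real.pi))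
    (hinc : ∀ x ∈ Set.Ioo 0 xmax, 0 < deriv u x)
    (hdec : ∀ x ∈ Set.Ioo xmax (2 * Real.pi), deriv u x < 0)
    (ξm ξp : ℝ) (hξm : ξm ∈ Set.Ioo 0 xmax) (hξp : ξp ∈ Set.Ioo xmax (2 * Real.pi))
    (hm0 : deriv (deriv u) ξm = 0) (hp0 : deriv (deriv u) ξp = 0)
    (hm3 : deriv (deriv (deriv u)) ξm ≠ 0) (hp3 : deriv (deriv (deriv u)) ξp ≠ 0)
    (honly : ∀ x ∈ Set.Ico 0 (2 * Real.pi), deriv (deriv u) x = 0 → x = ξm ∨ x = ξp)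
    (uN : ℕ → ℝ → ℝ)
    (huN : ∀ N x, uN N x =
      (∑ k ∈ Finset.Icc (-(N : ℤ)) (N : ℤ),
        ((1 / (2 * Real.pi) : ℂ) *
            ∫ y in (0 : ℝ)..(2 * Real.pi), (u y : ℂ) * Complex.exp (-(k : ℂ) * y * Complex.I)) *
          Complex.exp ((k : ℂ) * x * Complex.I)).re) :
    ∃ (N₀ : ℕ) (xminN xmaxN : ℕ → ℝ),
      Tendsto xminN atTop (nhds 0) ∧
      Tendsto xmaxN atTop (nhds xmax) ∧
      ∀ N : ℕ, N₀ ≤ N →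
        StrictMonoOn (uN N) (Set.Ioo (xminN N) (xmaxN N)) ∧
        StrictAntiOn (uN N) (Set.Ioo (xmaxN N) (xminN N + 2 * Real.pi)) := by
  have hp1 : ∀ h : ℝ → ℝ, (∀ x, h (x + 2 * Real.pi) = h x) →
      ∀ x, deriv h (x + 2 * Real.pi) = deriv h x := by
    intro h hh x
    rw [← deriv_comp_add_const]
    congr 1
    ext y
    exact hh y
  have c1 : ContDiff ℝ 2 (deriv u) :=
    ((contDiff_succ_iff_deriv (n := 2)).1 (by simpa [show (2 : WithTop ℕ∞) + 1 = 3 by norm_num] using hu)).2.2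
  have c2 : ContDiff ℝ 1 (deriv (deriv u)) :=
    ((contDiff_succ_iff_deriv (n := 1)).1 (by simpa [show (1 : WithTop ℕ∞) + 1 = 2 by norm_num] using c1)).2.2
  have c3 : Continuous (deriv (deriv (deriv u))) := c2.continuous_deriv le_rfl
  have d0 : ∀ x, HasDerivAt u (deriv u x) x := fun x =>
    (hu.differentiable (by norm_num) x).hasDerivAt
  have d1 : ∀ x, HasDerivAt (deriv u) (deriv (deriv u) x) x := fun x =>
    (c1.differentiable (by norm_num) x).hasDerivAt
  have d2 : ∀ x, HasDerivAt (deriv (deriv u)) (deriv (deriv (deriv u)) x) x := fun x =>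
    (c2.differentiable (by norm_num) x).hasDerivAt
  have p0 : ∀ x, u (x + 2 * Real.pi) = u x := hper
  have p1 := hp1 _ p0
  have p2 := hp1 _ p1
  have p3 := hp1 _ p2
  have huS : ∀ N, uN N = fS u N := fun N => funext fun x => huN N x
  obtain ⟨x, y, hx, hy, hev⟩ := aux_main (deriv u) (deriv (deriv u)) (fS (deriv u))
    (fS (deriv (deriv u))) xmax (2 * Real.pi) hxmax p1 (fS_per _) d1 c2.continuous
    (fS_deriv _ _ p1 d1 c2.continuous) (fS_unif _ _ p1 p2 d1 c2.continuous)
    (fS_unif _ _ p2 p3 d2 c3) hinc hdec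
    (fun h => by
      rcases honly 0 ⟨le_rfl, Real.two_pi_pos⟩ h with h | h
      · exact absurd h hξm.1.ne
      · exact absurd h (hxmax.1.trans hξp.1).ne)
    (fun h => by
      rcases honly xmax ⟨hxmax.1.le, hxmax.2⟩ h with h | h
      · exact absurd h hξm.2.ne'
      · exact absurd h hξp.1.ne)
  obtain ⟨N₀, hN₀⟩ := eventually_atTop.1 hev
  refine ⟨N₀, x, y, hx, hy, fun N hN => ?_⟩
  have dN := fS_deriv u _ p0 d0 c1.continuous N
  obtain ⟨e1, e2⟩ := hN₀ N hN
  rw [huS]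
  constructor
  · apply strictMonoOn_of_deriv_pos (convex_Ioo _ _)
      (fun z _ => (dN z).continuousAt.continuousWithinAt)
    intro z hz
    rw [(dN z).deriv]
    exact e1 z (interior_subset hz)
  · apply strictAntiOn_of_deriv_neg (convex_Ioo _ _)
      (fun z _ => (dN z).continuousAt.continuousWithinAt)
    intro z hz
    rw [(dN z).deriv]
    exact e2 z (interior_subset hz)
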